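/- Let $\{a_n\},\{b_n\},\{c_n\},\{d_n\}$ be real sequences with $1\le a_n\le b_n$ for all $n$, and $\psi:\mathbb{N}\to[0,\infty)$. Then the Hausdorff dimension of $M(\psi)=\{x\in[0,1]:\|a_nx+c_n\|\cdot\|b_nx+d_n\|<\psi(n)\text{ for infinitely many }n\}$ is at most $\min\{1,\tau\}$, where $\tau=\inf\{s>0:\sum_{n}[b_n(\psi(n)/b_n)^s+a_n(\psi(n)/(a_nb_n))^{s/2}]<\infty\}$. -/

import Mathlib

open Set MeasureTheory
open scoped ENNReal

/-- Distance from `x` to the nearest integer. -/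
noncomputable def nint (x : ℝ) : ℝ := |x - round x|

/-- **Hausdorff–Cantelli lemma**. -/
theorem dimH_setOf_infinite_mem_le {X : Type*} [EMetricSpace X] {s : ℝ} (hs : 0 < s)
    {ι : ℕ → Type*} [∀ n, Countable (ι n)] (E : ℕ → Set X) (t : ∀ n, ι n → Set X)
    (hE : ∀ n, E n ⊆ ⋃ i, t n i)
    (hsum : ∑' n, ∑' i, Metric.ediam (t n i) ^ s ≠ ∞) :
    dimH {x | {n | x ∈ E n}.Infinite} ≤ ENNReal.ofReal s := by
  borelize X
  have htail := ENNReal.tendsto_sum_nat_add _ hsum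
  have hroot : Filter.Tendsto
      (fun N => (∑' n, ∑' i, Metric.ediam (t (n + N) i) ^ s) ^ s⁻¹) Filter.atTop (nhds 0) := by
    have := (ENNReal.continuous_rpow_const (y := s⁻¹)).tendsto 0 |>.comp htail
    rwa [ENNReal.zero_rpow_of_pos (inv_pos.2 hs)] at this
  have hle := Measure.hausdorffMeasure_le_liminf_tsum
    (ι := fun N => Σ n, ι (n + N)) s {x | {n | x ∈ E n}.Infinite} _ hroot
    (fun N p => t (p.1 + N) p.2)
    (.of_forall fun N p => by
      rw [ENNReal.le_rpow_inv_iff hs]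
      exact (ENNReal.le_tsum (f := fun i => Metric.ediam (t (p.1 + N) i) ^ s) p.2).trans
        (ENNReal.le_tsum (f := fun n => ∑' i, Metric.ediam (t (n + N) i) ^ s) p.1))
    (.of_forall fun N x hx => by
      obtain ⟨n, hn, hNn⟩ := Set.Infinite.exists_gt hx N
      obtain ⟨m, rfl⟩ := Nat.exists_eq_add_of_le' hNn.le
      obtain ⟨i, hi⟩ := mem_iUnion.1 (hE _ hn)
      exact mem_iUnion.2 ⟨⟨m, i⟩, hi⟩)
  simp only [ENNReal.tsum_sigma'] at hle
  rw [htail.liminf_eq] at hle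
  refine dimH_le_of_hausdorffMeasure_ne_top ?_
  rw [Real.coe_toNNReal s hs.le, nonpos_iff_eq_zero.1 hle]
  exact ENNReal.zero_ne_top

theorem sum_range_rpow_neg_le {s : ℝ} (hs : 0 < s) (hs1 : s < 1) (K : ℕ) :
    ∑ k ∈ Finset.range (K + 1), (k : ℝ) ^ (-s) ≤ (K : ℝ) ^ (1 - s) / (1 - s) := by
  have h1s : 0 < 1 - s := sub_pos.2 hs1
  induction K with
  | zero => simp [Real.zero_rpow (neg_ne_zero.2 hs.ne'), Real.zero_rpow h1s.ne']
  | succ K ih =>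
    rw [Finset.sum_range_succ]
    have hK : (0 : ℝ) < ((K + 1 : ℕ) : ℝ) := by positivity
    have hbern : (K : ℝ) ^ (1 - s) ≤
        ((K + 1 : ℕ) : ℝ) ^ (1 - s) - (1 - s) * ((K + 1 : ℕ) : ℝ) ^ (-s) := by
      have hinv : ((K + 1 : ℕ) : ℝ)⁻¹ ≤ 1 := inv_le_one_of_one_le₀ (by simp)
      have h := rpow_one_add_le_one_add_mul_self (s := -((K + 1 : ℕ) : ℝ)⁻¹) (by linarith)
        h1s.le (by linarith)
      have hfac : (K : ℝ) = ((K + 1 : ℕ) : ℝ) * (1 + -((K + 1 : ℕ) : ℝ)⁻¹) := by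
        field_simp; push_cast; ring
      have hsplit : ((K + 1 : ℕ) : ℝ) ^ (-s) =
          ((K + 1 : ℕ) : ℝ) ^ (1 - s) * ((K + 1 : ℕ) : ℝ)⁻¹ := by
        rw [← Real.rpow_neg_one, ← Real.rpow_add hK]; ring_nf
      rw [hsplit]
      conv_lhs => rw [hfac]
      rw [Real.mul_rpow hK.le (by linarith)]
      calc _ ≤ _ := mul_le_mul_of_nonneg_left h (by positivity)
        _ = _ := by ring
    rw [le_div_iff₀ h1s] at ih ⊢
    linarith

theorem sum_Icc_abs_rpow_neg_le {s : ℝ} (hs : 0 < s) (hs1 : s < 1) (K : ℕ) :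
    ∑ k ∈ Finset.Icc (-K : ℤ) K, |(k : ℝ)| ^ (-s) ≤ 2 * ((K : ℝ) ^ (1 - s) / (1 - s)) := by
  rw [Finset.sum_Icc_of_even_eq_range (f := fun k : ℤ => |(k : ℝ)| ^ (-s))
    (fun k => by simp)]
  have := sum_range_rpow_neg_le hs hs1 K
  simpa [Real.zero_rpow (neg_ne_zero.2 hs.ne')] using this

theorem card_Icc_ceil_floor_le {u v : ℝ} (h : u ≤ v + 1) :
    ((Finset.Icc ⌈u⌉ ⌊v⌋).card : ℝ) ≤ v - u + 1 := by
  rw [Int.card_Icc]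
  have h1 := Int.le_ceil u
  have h2 := Int.floor_le v
  rcases le_total (⌊v⌋ + 1 - ⌈u⌉) 0 with h0 | h0
  · rw [Int.toNat_of_nonpos h0]; push_cast; linarith
  · have : (((⌊v⌋ + 1 - ⌈u⌉).toNat : ℤ) : ℝ) = ((⌊v⌋ + 1 - ⌈u⌉ : ℤ) : ℝ) := by
      rw [Int.toNat_of_nonneg h0]
    push_cast at this
    linarith

/-- If `|x - α| * |x - β|` is small then `x` is close to `α` or `β`, and close to `β` with a gain
from the separation of `α` and `β` unless it is close to `α`. -/
theorem abs_sub_lt_of_mul_lt {x α β ε : ℝ} (h : |x - α| * |x - β| < ε) (hαβ : α ≠ β) :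
    |x - α| < √ε ∨ |x - β| ≤ 2 * ε / |α - β| := by
  have hδ : 0 < |α - β| := abs_pos.2 (sub_ne_zero.2 hαβ)
  have htri : |α - β| ≤ |x - α| + |x - β| := by
    rw [abs_sub_comm x α]; exact abs_sub_le α x β
  rcases lt_or_ge |x - α| (|α - β| / 2) with h1 | h1
  · left
    apply Real.lt_sqrt_of_sq_lt
    nlinarith [abs_nonneg (x - α)]
  · right
    rw [le_div_iff₀ hδ]
    nlinarith [abs_nonneg (x - β)]

/-- The intervals used to cover the points near `α = (p - c) / a`: two intervals of length
comparable to `√ε` and, for `k ≠ 0`, one of length comparable to `ε b / |k|` around the `k`-th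
neighbour of `α` among the points `(q - d) / b`, where `ε = ψ / (a b)`. -/
noncomputable def coverBall (a b c d ψ : ℝ) (p : ℤ) : Bool ⊕ ℤ → Set ℝ
  | .inl false => Metric.closedBall ((p - c) / a) √(ψ / (a * b))
  | .inl true =>
    Metric.closedBall ((round (b * ((p - c) / a) + d) - d) / b) √(ψ / (a * b))
  | .inr k =>
    Metric.closedBall ((round (b * ((p - c) / a) + d) + k - d) / b) (4 * (ψ / a) / |(k : ℝ)|)

theorem exists_mem_coverBall {a b c d ψ x : ℝ} (ha : 1 ≤ a) (hab : a ≤ b) (hx : x ∈ Icc (0 : ℝ) 1)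
    (h : nint (a * x + c) * nint (b * x + d) < ψ) :
    ∃ p ∈ Finset.Icc ⌈c - 1 / 2⌉ ⌊a + c + 1 / 2⌋,
      (∃ e, x ∈ coverBall a b c d ψ p (.inl e)) ∨
        ∃ k ∈ Finset.Icc (-⌊2 * b / a⌋₊ : ℤ) ⌊2 * b / a⌋₊, x ∈ coverBall a b c d ψ p (.inr k) := by
  have ha0 : 0 < a := by linarith
  have hb0 : 0 < b := by linarith
  have hp := abs_le.1 (abs_sub_round (a * x + c))
  have hq := abs_sub_round (b * x + d)
  set p := round (a * x + c) with hpdef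
  set q := round (b * x + d) with hqdef
  refine ⟨p, ?_, ?_⟩
  · rw [Finset.mem_Icc, Int.ceil_le, Int.le_floor]
    constructor <;> nlinarith [hx.1, hx.2]
  set α : ℝ := (p - c) / a with hα
  set β : ℝ := (q - d) / b with hβ
  have hxα : |a * x + c - p| = a * |x - α| := by
    rw [← abs_of_pos ha0, ← abs_mul, abs_of_pos ha0, hα]; congr 1; field_simp; ring
  have hxβ : |b * x + d - q| = b * |x - β| := by
    rw [← abs_of_pos hb0, ← abs_mul, abs_of_pos hb0, hβ]; congr 1; field_simp; ring
  have hprod : |x - α| * |x - β| < ψ / (a * b) := by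
    rw [lt_div_iff₀ (by positivity)]
    simp only [nint, ← hpdef, ← hqdef, hxα, hxβ] at h
    linarith
  set m := round (b * α + d) with hm
  have hm2 := abs_sub_round (b * α + d)
  rw [← hm] at hm2
  by_cases hqm : q = m
  · left
    rcases le_total |x - α| |x - β| with hle | hle
    · refine ⟨false, ?_⟩
      rw [coverBall, Metric.mem_closedBall, Real.dist_eq]
      exact Real.le_sqrt_of_sq_le (by nlinarith [abs_nonneg (x - α)])
    · refine ⟨true, ?_⟩
      rw [coverBall, Metric.mem_closedBall, Real.dist_eq, ← hα, ← hm, ← hqm]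
      exact Real.le_sqrt_of_sq_le (by nlinarith [abs_nonneg (x - β)])
  have hk1 : (1 : ℝ) ≤ |((q - m : ℤ) : ℝ)| := by
    rw [← Int.cast_abs]; exact_mod_cast Int.one_le_abs (sub_ne_zero.2 hqm)
  have hbβα : b * |α - β| = |((q - m : ℤ) : ℝ) - (b * α + d - m)| := by
    rw [← abs_of_pos hb0, ← abs_mul, abs_of_pos hb0, hβ, abs_sub_comm]
    congr 1; push_cast; field_simp; ring
  have hlow : |((q - m : ℤ) : ℝ)| / 2 ≤ b * |α - β| := by
    have := abs_sub_abs_le_abs_sub ((q - m : ℤ) : ℝ) (b * α + d - m)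
    linarith
  have hαβ : α ≠ β := by
    intro h; rw [h, sub_self, abs_zero] at hlow; linarith
  rcases abs_sub_lt_of_mul_lt hprod hαβ with h1 | h1
  · exact .inl ⟨false, by
      rw [coverBall, Metric.mem_closedBall, Real.dist_eq]; exact h1.le⟩
  refine .inr ⟨q - m, ?_, ?_⟩
  · have htri : |α - β| ≤ |x - α| + |x - β| := by
      rw [abs_sub_comm x α]; exact abs_sub_le α x β
    have hup : |((q - m : ℤ) : ℝ)| ≤ b * |α - β| + 1 / 2 := by
      have := abs_sub_abs_le_abs_sub ((q - m : ℤ) : ℝ) (b * α + d - m)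
      linarith
    have hxα' : b * |x - α| ≤ b / a / 2 := by
      rw [div_div, le_div_iff₀ (by positivity)]
      have : a * |x - α| ≤ 1 / 2 := hxα ▸ abs_le.2 hp
      nlinarith
    have hba : 1 ≤ b / a := (one_le_div ha0).2 hab
    have hle : |((q - m : ℤ) : ℝ)| ≤ 2 * b / a := by
      rw [mul_div_assoc]
      nlinarith
    have hnat : |q - m| ≤ (⌊2 * b / a⌋₊ : ℤ) := by
      rw [Int.natCast_floor_eq_floor (by positivity), Int.le_floor]
      exact_mod_cast hle
    exact Finset.mem_Icc.2 (abs_le.1 hnat)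
  · rw [coverBall, Metric.mem_closedBall, Real.dist_eq, ← hα, ← hm]
    have hc : ((m : ℝ) + ((q - m : ℤ) : ℝ) - d) / b = β := by rw [hβ]; push_cast; ring
    rw [hc]
    refine h1.trans ?_
    have hψ : 0 < ψ / (a * b) := lt_of_le_of_lt (by positivity) hprod
    rw [div_le_div_iff₀ (abs_pos.2 (sub_ne_zero.2 hαβ)) (by linarith)]
    have he : ψ / a = b * (ψ / (a * b)) := by field_simp
    rw [he]
    nlinarith

theorem ediam_closedBall_rpow_le (x : ℝ) {r s : ℝ} (hr : 0 ≤ r) (hs : 0 ≤ s) :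
    Metric.ediam (Metric.closedBall x r) ^ s ≤ ENNReal.ofReal ((2 * r) ^ s) := by
  rw [← ENNReal.ofReal_rpow_of_nonneg (by positivity) hs, Real.closedBall_eq_Icc, Real.ediam_Icc]
  gcongr
  linarith

theorem sum_ediam_coverBall_le {a b ψ s : ℝ} (c d : ℝ) (ha : 1 ≤ a) (hab : a ≤ b) (hψ : 0 ≤ ψ)
    (hs : 0 < s) (hs1 : s < 1) :
    ∑ p ∈ Finset.Icc ⌈c - 1 / 2⌉ ⌊a + c + 1 / 2⌋,
      (∑ e, Metric.ediam (coverBall a b c d ψ p (.inl e)) ^ s +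
        ∑ k ∈ Finset.Icc (-⌊2 * b / a⌋₊ : ℤ) ⌊2 * b / a⌋₊,
          Metric.ediam (coverBall a b c d ψ p (.inr k)) ^ s) ≤
      ENNReal.ofReal (96 / (1 - s) * (b * (ψ / b) ^ s + a * (ψ / (a * b)) ^ (s / 2))) := by
  have ha0 : 0 < a := by linarith
  have hb0 : 0 < b := by linarith
  have h1s : 0 < 1 - s := sub_pos.2 hs1
  have hε : 0 ≤ ψ / (a * b) := by positivity
  have hK : (⌊2 * b / a⌋₊ : ℝ) ≤ 2 * b / a := Nat.floor_le (by positivity)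
  have hcard : ((Finset.Icc ⌈c - 1 / 2⌉ ⌊a + c + 1 / 2⌋).card : ℝ) ≤ 3 * a :=
    (card_Icc_ceil_floor_le (by linarith)).trans (by linarith)
  have hpow {y : ℝ} (hy : 1 ≤ y) {r : ℝ} (hr : r ≤ 1) : y ^ r ≤ y := by
    simpa using Real.rpow_le_rpow_of_exponent_le hy hr
  have hsqrt : (2 * √(ψ / (a * b))) ^ s ≤ 2 * (ψ / (a * b)) ^ (s / 2) := by
    rw [Real.mul_rpow (by norm_num) (Real.sqrt_nonneg _), Real.sqrt_eq_rpow, ← Real.rpow_mul hε,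
      one_div_mul_eq_div]
    gcongr
    exact hpow (by norm_num) hs1.le
  have hgap (k : ℤ) : (2 * (4 * (ψ / a) / |(k : ℝ)|)) ^ s ≤ 8 * (ψ / a) ^ s * |(k : ℝ)| ^ (-s) := by
    have : 2 * (4 * (ψ / a) / |(k : ℝ)|) = 8 * (ψ / a) / |(k : ℝ)| := by ring
    rw [this, Real.div_rpow (by positivity) (abs_nonneg _), Real.mul_rpow (by norm_num)
      (by positivity), Real.rpow_neg (abs_nonneg _), ← div_eq_mul_inv]
    gcongr
    exact hpow (by norm_num) hs1.le
  have hsumK : ∑ k ∈ Finset.Icc (-⌊2 * b / a⌋₊ : ℤ) ⌊2 * b / a⌋₊, |(k : ℝ)| ^ (-s) ≤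
      4 / (1 - s) * (b / a) ^ (1 - s) := by
    refine (sum_Icc_abs_rpow_neg_le hs hs1 _).trans ?_
    have : (⌊2 * b / a⌋₊ : ℝ) ^ (1 - s) ≤ 2 * (b / a) ^ (1 - s) := by
      refine (Real.rpow_le_rpow (by positivity) hK h1s.le).trans ?_
      rw [mul_div_assoc, Real.mul_rpow (by norm_num) (by positivity)]
      gcongr
      exact hpow (by norm_num) (by linarith)
    calc _ ≤ 2 * (2 * (b / a) ^ (1 - s) / (1 - s)) := by gcongr
      _ = _ := by ring
  have hscale : a * ((ψ / a) ^ s * (b / a) ^ (1 - s)) = b * (ψ / b) ^ s := by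
    have hdiv : ψ / a = ψ / b * (b / a) := by field_simp
    rw [hdiv, Real.mul_rpow (by positivity) (by positivity), mul_assoc,
      ← Real.rpow_add (by positivity), add_sub_cancel, Real.rpow_one]
    field_simp
  have hfiber (p : ℤ) : ∑ e, Metric.ediam (coverBall a b c d ψ p (.inl e)) ^ s +
        ∑ k ∈ Finset.Icc (-⌊2 * b / a⌋₊ : ℤ) ⌊2 * b / a⌋₊,
          Metric.ediam (coverBall a b c d ψ p (.inr k)) ^ s ≤
      ENNReal.ofReal (4 * (ψ / (a * b)) ^ (s / 2) +
        32 / (1 - s) * ((ψ / a) ^ s * (b / a) ^ (1 - s))) := by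
    rw [ENNReal.ofReal_add (by positivity) (by positivity)]
    gcongr ?_ + ?_
    · have h2 : (4 : ℝ) * (ψ / (a * b)) ^ (s / 2) =
          2 * (ψ / (a * b)) ^ (s / 2) + 2 * (ψ / (a * b)) ^ (s / 2) := by ring
      rw [Fintype.sum_bool, h2, ENNReal.ofReal_add (by positivity) (by positivity)]
      gcongr ?_ + ?_ <;>
      exact (ediam_closedBall_rpow_le _ (Real.sqrt_nonneg _) hs.le).trans
        (ENNReal.ofReal_le_ofReal hsqrt)
    · calc _ ≤ ∑ k ∈ Finset.Icc (-⌊2 * b / a⌋₊ : ℤ) ⌊2 * b / a⌋₊,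
            ENNReal.ofReal (8 * (ψ / a) ^ s * |(k : ℝ)| ^ (-s)) :=
            Finset.sum_le_sum fun k _ =>
              (ediam_closedBall_rpow_le _ (by positivity) hs.le).trans
                (ENNReal.ofReal_le_ofReal (hgap k))
        _ = ENNReal.ofReal (8 * (ψ / a) ^ s *
            ∑ k ∈ Finset.Icc (-⌊2 * b / a⌋₊ : ℤ) ⌊2 * b / a⌋₊, |(k : ℝ)| ^ (-s)) := by
          rw [Finset.mul_sum, ENNReal.ofReal_sum_of_nonneg fun k _ => by positivity]
        _ ≤ ENNReal.ofReal (8 * (ψ / a) ^ s * (4 / (1 - s) * (b / a) ^ (1 - s))) := by gcongr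
        _ = _ := by congr 1; ring
  refine (Finset.sum_le_card_nsmul _ _ _ fun p _ => hfiber p).trans ?_
  rw [nsmul_eq_mul, ← ENNReal.ofReal_natCast, ← ENNReal.ofReal_mul (by positivity)]
  refine ENNReal.ofReal_le_ofReal ?_
  have h96 : 12 ≤ 96 / (1 - s) := by rw [le_div_iff₀ h1s]; linarith
  calc _ ≤ 3 * a * (4 * (ψ / (a * b)) ^ (s / 2) +
        32 / (1 - s) * ((ψ / a) ^ s * (b / a) ^ (1 - s))) := by gcongr
    _ = 12 * (a * (ψ / (a * b)) ^ (s / 2)) +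
        96 / (1 - s) * (a * ((ψ / a) ^ s * (b / a) ^ (1 - s))) := by ring
    _ ≤ 96 / (1 - s) * (a * (ψ / (a * b)) ^ (s / 2)) + 96 / (1 - s) * (b * (ψ / b) ^ s) := by
      rw [hscale]; gcongr
    _ = _ := by ring

theorem stmt12 (a b c d : ℕ → ℝ) (ψ : ℕ → ℝ)
    (ha : ∀ n, 1 ≤ a n) (hab : ∀ n, a n ≤ b n) (hψ : ∀ n, 0 ≤ ψ n) :
    dimH {x ∈ Icc (0:ℝ) 1 |
        {n : ℕ | nint (a n * x + c n) * nint (b n * x + d n) < ψ n}.Infinite}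
      ≤ min 1 (sInf {e : ℝ≥0∞ | ∃ s : ℝ, 0 < s ∧ e = ENNReal.ofReal s ∧
          Summable (fun n =>
            b n * (ψ n / b n) ^ s + a n * (ψ n / (a n * b n)) ^ (s / 2))}) := by
  have hone (S : Set ℝ) : dimH S ≤ 1 := Real.dimH_univ ▸ dimH_mono (subset_univ S)
  refine le_min (hone _) (le_sInf ?_)
  rintro _ ⟨s, hs, rfl, hsum⟩
  rcases le_or_gt 1 s with hs1 | hs1
  · exact (hone _).trans (by simpa using hs1)
  let P (n : ℕ) := Finset.Icc ⌈c n - 1 / 2⌉ ⌊a n + c n + 1 / 2⌋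
  let K (n : ℕ) := Finset.Icc (-⌊2 * b n / a n⌋₊ : ℤ) ⌊2 * b n / a n⌋₊
  let E (n : ℕ) :=
    {x ∈ Icc (0 : ℝ) 1 | nint (a n * x + c n) * nint (b n * x + d n) < ψ n}
  have hsub : {x ∈ Icc (0:ℝ) 1 |
      {n : ℕ | nint (a n * x + c n) * nint (b n * x + d n) < ψ n}.Infinite} ⊆
      {x | {n | x ∈ E n}.Infinite} :=
    fun x hx => hx.2.mono fun n hn => ⟨hx.1, hn⟩
  refine (dimH_mono hsub).trans (dimH_setOf_infinite_mem_le hs (ι := fun n => P n × (Bool ⊕ K n)) E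
    (fun n i => coverBall (a n) (b n) (c n) (d n) (ψ n) i.1 (i.2.map id (↑))) ?_ ?_)
  · rintro n x ⟨hx, h⟩
    obtain ⟨p, hp, ⟨e, he⟩ | ⟨k, hk, hxk⟩⟩ := exists_mem_coverBall (ha n) (hab n) hx h
    · exact mem_iUnion.2 ⟨⟨⟨p, hp⟩, .inl e⟩, he⟩
    · exact mem_iUnion.2 ⟨⟨⟨p, hp⟩, .inr ⟨k, hk⟩⟩, hxk⟩
  · refine ne_top_of_le_ne_top (hsum.mul_left (96 / (1 - s))).tsum_ofReal_ne_top
      (ENNReal.tsum_le_tsum fun n => ?_)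
    refine le_of_eq_of_le ?_ (sum_ediam_coverBall_le (c n) (d n) (ha n) (hab n) (hψ n) hs hs1)
    rw [tsum_fintype, Fintype.sum_prod_type, ← Finset.sum_coe_sort (P n)]
    refine Finset.sum_congr rfl fun p _ => ?_
    rw [Fintype.sum_sum_type, ← Finset.sum_coe_sort (K n)]
    rfl
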